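/- There exists a constant c > 0 with the following property. Let k : ℕ → ℕ and r : ℕ → ℝ be functions with n/(4·ln n) < k(n) ≤ n and r(n) ≥ √( c · ln(ln n) / k(n) ) for all sufficiently large n. Then the probability that the toroidal random geometric graph G(n, r(n)) contains an independent set of size k(n) tends to 0 as n → ∞. -/

import Mathlib

open MeasureTheory Filter

noncomputable section

/-- The half-open unit square `[0,1)²`, viewed as the unit flat torus. -/
def torusSquare : Set (EuclideanSpace ℝ (Fin 2)) := {x | ∀ i, x i ∈ Set.Ico (0 : ℝ) 1}

/-- The distribution of `n` independent uniform points on `[0,1)²`. -/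
def torusMeasure (n : ℕ) : Measure (Fin n → EuclideanSpace ℝ (Fin 2)) :=
  Measure.pi fun _ => volume.restrict torusSquare

/-- The toroidal distance: `d(x,y)` is the infimum of `‖x - y + v‖` over
shifts `v ∈ {-1,0,1}²`. -/
def torusDist (x y : EuclideanSpace ℝ (Fin 2)) : ℝ :=
  sInf {d : ℝ | ∃ v : EuclideanSpace ℝ (Fin 2),
    (∀ i, v i ∈ ({-1, 0, 1} : Set ℝ)) ∧ d = ‖x - y + v‖}

/-- The event that the toroidal random geometric graph with distance parameter `r` contains
an independent set of size `k`: `k` vertices, no two of which are within toroidal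
distance `r`. -/
def HasIndepSet (n : ℕ) (r : ℝ) (k : ℕ) (x : Fin n → EuclideanSpace ℝ (Fin 2)) : Prop :=
  ∃ S : Finset (Fin n), S.card = k ∧
    ∀ i ∈ S, ∀ j ∈ S, i ≠ j → ¬ torusDist (x i) (x j) ≤ r

theorem torusDist_le (x y : EuclideanSpace ℝ (Fin 2)) : torusDist x y ≤ ‖x - y‖ := by
  unfold torusDist
  apply csInf_le
  · refine ⟨0, ?_⟩
    rintro d ⟨v, _, rfl⟩
    exact norm_nonneg _
  · exact ⟨0, by simp, by simp⟩

theorem measurableSet_torusSquare : MeasurableSet torusSquare := by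
  unfold torusSquare
  rw [Set.setOf_forall]
  refine MeasurableSet.iInter fun i => ?_
  have h : Measurable (fun x : EuclideanSpace ℝ (Fin 2) => x i) := by fun_prop
  exact h measurableSet_Ico

theorem torusMeasure_ae (n : ℕ) : ∀ᵐ x ∂(torusMeasure n), ∀ i, x i ∈ torusSquare := by
  rw [ae_all_iff]
  intro i
  unfold torusMeasure
  exact (Measure.tendsto_eval_ae_ae (i := i)).eventually
    (ae_restrict_mem measurableSet_torusSquare)

theorem abs_sub_of_floor {m : ℕ} {a b : ℝ} (ha : 0 ≤ a) (hb : 0 ≤ b)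
    (h : ⌊(m : ℝ) * a⌋₊ = ⌊(m : ℝ) * b⌋₊) : ((m : ℝ) * (a - b)) ^ 2 ≤ 1 := by
  have h1 := Nat.floor_le (show 0 ≤ (m : ℝ) * a by positivity)
  have h2 := Nat.floor_le (show 0 ≤ (m : ℝ) * b by positivity)
  have h3 := Nat.lt_floor_add_one ((m : ℝ) * a)
  have h4 := Nat.lt_floor_add_one ((m : ℝ) * b)
  rw [h] at h1 h3
  rw [sq_le_one_iff_abs_le_one, abs_le]
  constructor <;> linarith

theorem not_indep {n k m : ℕ} {r : ℝ} (hm : 0 < m) (hmk : m * m < k)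
    (hr0 : 0 ≤ r) (hr : 2 ≤ (m : ℝ) ^ 2 * r ^ 2)
    {x : Fin n → EuclideanSpace ℝ (Fin 2)} (hx : ∀ i, x i ∈ torusSquare) :
    ¬ HasIndepSet n r k x := by
  rintro ⟨S, hS, hind⟩
  have hmR : (0 : ℝ) < m := by exact_mod_cast hm
  have hfl : ∀ i j, ⌊(m : ℝ) * x i j⌋₊ < m := by
    intro i j
    have := hx i j
    rw [Nat.floor_lt (mul_nonneg hmR.le this.1)]
    nlinarith [this.2]
  obtain ⟨i, hi, j, hj, hij, he⟩ := Finset.exists_ne_map_eq_of_card_lt_of_maps_to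
    (s := S) (t := Finset.range m ×ˢ Finset.range m)
    (f := fun i => (⌊(m : ℝ) * x i 0⌋₊, ⌊(m : ℝ) * x i 1⌋₊))
    (by simpa [hS] using hmk)
    (by intro i _; simp [hfl])
  rw [Prod.mk.injEq] at he
  apply hind i hi j hj hij
  refine (torusDist_le _ _).trans ?_
  have a0 := abs_sub_of_floor (hx i 0).1 (hx j 0).1 he.1
  have a1 := abs_sub_of_floor (hx i 1).1 (hx j 1).1 he.2
  have hn : ‖x i - x j‖ ^ 2 = (x i 0 - x j 0) ^ 2 + (x i 1 - x j 1) ^ 2 := by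
    rw [EuclideanSpace.norm_sq_eq]
    simp [Fin.sum_univ_two]
  refine (sq_le_sq₀ (norm_nonneg _) hr0).1 ?_
  refine le_of_mul_le_mul_left ?_ (show (0 : ℝ) < (m : ℝ) ^ 2 by positivity)
  rw [hn]
  nlinarith

theorem no_huge_indep_set :
    ∃ c : ℝ, 0 < c ∧
      ∀ (k : ℕ → ℕ) (r : ℕ → ℝ),
        (∀ᶠ n : ℕ in atTop,
          (n : ℝ) / (4 * Real.log n) < (k n : ℝ) ∧ k n ≤ n ∧
            Real.sqrt (c * Real.log (Real.log n) / (k n : ℝ)) ≤ r n) →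
        Tendsto (fun n : ℕ => torusMeasure n {x | HasIndepSet n (r n) (k n) x})
          atTop (nhds 0) := by
  refine ⟨1, one_pos, fun k r h => ?_⟩
  refine tendsto_const_nhds.congr' ?_
  have hlog : Tendsto (fun n : ℕ => Real.log n) atTop atTop :=
    Real.tendsto_log_atTop.comp tendsto_natCast_atTop_atTop
  have hll := Real.tendsto_log_atTop.comp hlog
  have hlo : ∀ᶠ n : ℕ in atTop, ‖Real.log n‖ ≤ (1 / 4) * ‖(n : ℝ)‖ :=
    tendsto_natCast_atTop_atTop.eventually
      (Real.isLittleO_log_id_atTop.bound (show (0 : ℝ) < 1 / 4 by norm_num))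
  filter_upwards [h, hlog.eventually_ge_atTop 1, hll.eventually_ge_atTop 8, hlo]
    with n ⟨hk, _, hr⟩ h1 h8 h4
  have h8' : 8 ≤ Real.log (Real.log n) := h8
  rw [Real.norm_of_nonneg (by linarith), Real.norm_of_nonneg (by positivity)] at h4
  have hk1 : (1 : ℝ) < k n := by
    refine lt_of_le_of_lt ?_ hk
    rw [le_div_iff₀ (by linarith)]
    linarith
  have hk2 : 1 < k n := by exact_mod_cast hk1
  obtain ⟨m, hm, hm1, hm2⟩ : ∃ m : ℕ, 0 < m ∧ m * m < k n ∧ k n ≤ 4 * (m * m) := by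
    have a := Nat.sqrt_le (k n - 1)
    have c := Nat.lt_succ_sqrt (k n - 1)
    have d : 0 < Nat.sqrt (k n - 1) := Nat.sqrt_pos.2 (by omega)
    refine ⟨Nat.sqrt (k n - 1), d, by omega, ?_⟩
    simp only [Nat.succ_eq_add_one] at c
    generalize Nat.sqrt (k n - 1) = s at *
    have : k n ≤ (s + 1) * (s + 1) := by omega
    nlinarith
  have hr0 : 0 ≤ r n := (Real.sqrt_nonneg _).trans hr
  have hr2 := (Real.sqrt_le_left hr0).1 hr
  have hm2' : (k n : ℝ) ≤ 4 * (m * m) := by exact_mod_cast hm2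
  have hr3 : 2 ≤ (m : ℝ) ^ 2 * r n ^ 2 := by
    rw [div_le_iff₀ (by linarith)] at hr2
    nlinarith [sq_nonneg (r n)]
  symm
  have hae := torusMeasure_ae n
  refine measure_mono_null ?_ (ae_iff.1 hae)
  intro x hx hx'
  exact not_indep hm hm1 hr0 hr3 hx' hx
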